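/- Let b ≥ 2, n ≥ 1, let σ be a permutation of {0,…,b−1} with σ∘τ = τ∘σ, and let Σ ∈ {σ,σ̄}^n with l = l(Σ). Then (b^n·L2(R_{b,n}^Σ))^2 = (Φ_b^σ)^2·((n−2l)^2 − n) + Φ_b^σ·(1 − 1/(2b^n))·(2l−n) + n·Φ_b^{σ,(2)} + 3/8 + 1/(4b^n) − 1/(72·b^{2n}). -/

import Mathlib

open Finset
open scoped Classical

noncomputable section

namespace SymHamm

/-- The reversal permutation `τ(k) = b−1−k` on `{0,…,b−1}`. -/
def tauP (b : ℕ) : Equiv.Perm (Fin b) := Fin.revPerm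

/-- `σ̄ = τ ∘ σ`. -/
def pbar {b : ℕ} (σ : Equiv.Perm (Fin b)) : Equiv.Perm (Fin b) := σ.trans (tauP b)

/-- Value of a permutation of `Fin b` on a natural number. -/
def permVal {b : ℕ} (σ : Equiv.Perm (Fin b)) (k : ℕ) : ℕ :=
  if h : k < b then (σ ⟨k, h⟩ : ℕ) else 0

/-- Faure's function `φ_{b,h}^σ`, extended with period 1 to all of `ℝ`.
For `x ∈ [(k−1)/b, k/b)` (i.e. `k−1 = ⌊b·{x}⌋`), it equals
`A([0,h/b);k;Z_b^σ) − h·x` if `h ≤ σ(k−1)` and `(b−h)·x − A([h/b,1);k;Z_b^σ)` otherwise,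
where `A` counts the first `k` entries `σ(0)/b,…,σ(k−1)/b` of `Z_b^σ` in the interval. -/
def phi {b : ℕ} (σ : Equiv.Perm (Fin b)) (h : ℕ) (x : ℝ) : ℝ :=
  if h ≤ permVal σ (⌊(b : ℝ) * Int.fract x⌋).toNat then
    (((Finset.range ((⌊(b : ℝ) * Int.fract x⌋).toNat + 1)).filter
        (fun l => permVal σ l < h)).card : ℝ) - (h : ℝ) * Int.fract x
  else
    ((b : ℝ) - (h : ℝ)) * Int.fract x -
      (((Finset.range ((⌊(b : ℝ) * Int.fract x⌋).toNat + 1)).filter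
        (fun l => h ≤ permVal σ l)).card : ℝ)

/-- `φ_b^σ = ∑_{h=0}^{b−1} φ_{b,h}^σ`. -/
def phiS {b : ℕ} (σ : Equiv.Perm (Fin b)) (x : ℝ) : ℝ := ∑ h ∈ range b, phi σ h x

/-- `φ_b^{σ,(2)} = ∑_{h=0}^{b−1} (φ_{b,h}^σ)²`. -/
def phiS2 {b : ℕ} (σ : Equiv.Perm (Fin b)) (x : ℝ) : ℝ := ∑ h ∈ range b, (phi σ h x) ^ 2

/-- `φ̃_b^σ = ∑_{h=0}^{b−1} φ_{b,h}^σ · φ_{b,h}^{σ̄}`. -/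
def phiT {b : ℕ} (σ : Equiv.Perm (Fin b)) (x : ℝ) : ℝ :=
  ∑ h ∈ range b, phi σ h x * phi (pbar σ) h x

/-- `φ̃_{b,1}^σ = ∑_{h=0}^{b−2} φ_{b,h+1}^σ · φ_{b,h}^{σ̄}`. -/
def phiT1 {b : ℕ} (σ : Equiv.Perm (Fin b)) (x : ℝ) : ℝ :=
  ∑ h ∈ range (b - 1), phi σ (h + 1) x * phi (pbar σ) h x

/-- `φ̃_{b,2}^σ = ∑_{h=0}^{b−2} φ_{b,h}^σ · φ_{b,h+1}^{σ̄}`. -/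
def phiT2 {b : ℕ} (σ : Equiv.Perm (Fin b)) (x : ℝ) : ℝ :=
  ∑ h ∈ range (b - 1), phi σ h x * phi (pbar σ) (h + 1) x

/-- `Φ_b^σ = (1/b)·∫_0^1 φ_b^σ`. -/
def PhiS {b : ℕ} (σ : Equiv.Perm (Fin b)) : ℝ := (1 / (b : ℝ)) * ∫ x in (0:ℝ)..1, phiS σ x

/-- `Φ_b^{σ,(2)} = (1/b)·∫_0^1 φ_b^{σ,(2)}`. -/
def PhiS2 {b : ℕ} (σ : Equiv.Perm (Fin b)) : ℝ := (1 / (b : ℝ)) * ∫ x in (0:ℝ)..1, phiS2 σ x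

/-- `Φ̃_b^σ = (1/b)·∫_0^1 φ̃_b^σ`. -/
def PhiT {b : ℕ} (σ : Equiv.Perm (Fin b)) : ℝ := (1 / (b : ℝ)) * ∫ x in (0:ℝ)..1, phiT σ x

/-- `Φ̃_{b,1}^σ = (1/b)·∫_0^1 φ̃_{b,1}^σ`. -/
def PhiT1 {b : ℕ} (σ : Equiv.Perm (Fin b)) : ℝ := (1 / (b : ℝ)) * ∫ x in (0:ℝ)..1, phiT1 σ x

/-- `Φ̃_{b,2}^σ = (1/b)·∫_0^1 φ̃_{b,2}^σ`. -/
def PhiT2 {b : ℕ} (σ : Equiv.Perm (Fin b)) : ℝ := (1 / (b : ℝ)) * ∫ x in (0:ℝ)..1, phiT2 σ x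

/-- `ν_j(N,Σ) = σ_j(N_j)·b^{n−j−1} + … + σ_{n−1}(N_{n−1})`, where `N_i` is the `i`-th
`b`-adic digit of `N`. -/
def nu (b n : ℕ) (S : Fin n → Equiv.Perm (Fin b)) (N j : ℕ) : ℕ :=
  ∑ i : Fin n,
    if j ≤ (i : ℕ) then permVal (S i) ((N / b ^ (i : ℕ)) % b) * b ^ (n - 1 - (i : ℕ)) else 0

/-- `ε_j(λ,N,Σ)`, for `1 ≤ j ≤ n`: it is `0` when `λ = bⁿ` or `N = bⁿ`; it is the last digit
`λ_n = λ % b` when `j = n`; otherwise, with `Λ_{j−1} = λ % b^{n−j+1}` and `ν_j = ν_j(N,Σ)`,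
it is `0` if `Λ_{j−1} ≤ ν_j`, it is `h` if `ν_j + (h−1)b^{n−j} < Λ_{j−1} ≤ ν_j + h·b^{n−j}`
for some `1 ≤ h < b`, and `0` if `ν_j + (b−1)b^{n−j} < Λ_{j−1} < b^{n−j+1}`. -/
def eps (b n : ℕ) (S : Fin n → Equiv.Perm (Fin b)) (lam N j : ℕ) : ℕ :=
  if lam = b ^ n ∨ N = b ^ n then 0
  else if j = n then lam % b
  else if lam % b ^ (n - j + 1) ≤ nu b n S N j then 0
  else ((lam % b ^ (n - j + 1) - nu b n S N j - 1) / b ^ (n - j) + 1) % b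

/-- The point of the digit-scrambled Hammersley point set `R_{b,n}^Σ` with digits `a`:
`(∑_{j=0}^{n−1} σ_j(a_j)/b^{n−j}, ∑_{j=0}^{n−1} a_j/b^{j+1})`. -/
def hammPt (b n : ℕ) (S : Fin n → Equiv.Perm (Fin b)) (a : Fin n → Fin b) : ℝ × ℝ :=
  (∑ j : Fin n, ((S j (a j) : ℕ) : ℝ) / (b : ℝ) ^ (n - (j : ℕ)),
   ∑ j : Fin n, ((a j : ℕ) : ℝ) / (b : ℝ) ^ ((j : ℕ) + 1))

/-- The symmetrized Hammersley point set `R_{b,n}^{Σ,sym} = R_{b,n}^Σ ∪ R_{b,n}^{Σ*}`,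
a family of `2·bⁿ` points. -/
def symFam (b n : ℕ) (S : Fin n → Equiv.Perm (Fin b)) :
    Bool × (Fin n → Fin b) → ℝ × ℝ :=
  fun p => if p.1 then hammPt b n S p.2 else hammPt b n (fun i => pbar (S i)) p.2

/-- Local discrepancy `E(x,y,P) = #{i : P i ∈ [0,x)×[0,y)} − N·x·y` of a finite family of
points, where `N` is the number of points. -/
def localDisc {ι : Type} [Fintype ι] (P : ι → ℝ × ℝ) (x y : ℝ) : ℝ :=
  ((Finset.univ.filter
      (fun i => 0 ≤ (P i).1 ∧ (P i).1 < x ∧ 0 ≤ (P i).2 ∧ (P i).2 < y)).card : ℝ)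
    - (Fintype.card ι : ℝ) * x * y

/-- `L_2` discrepancy `L2(P) = (1/N)·(∫_0^1∫_0^1 E(x,y,P)² dx dy)^{1/2}`. -/
def L2disc {ι : Type} [Fintype ι] (P : ι → ℝ × ℝ) : ℝ :=
  (1 / (Fintype.card ι : ℝ)) *
    Real.sqrt (∫ x in (0:ℝ)..1, ∫ y in (0:ℝ)..1, (localDisc P x y) ^ 2)


lemma permVal_lt {b : ℕ} (hb : 0 < b) (σ : Equiv.Perm (Fin b)) (k : ℕ) : permVal σ k < b := by
  unfold permVal
  split_ifs
  · exact (σ _).isLt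
  · exact hb

lemma permVal_fin {b : ℕ} (σ : Equiv.Perm (Fin b)) (k : Fin b) : permVal σ k = σ k := by
  simp [permVal]

lemma sum_permVal {b : ℕ} (σ : Equiv.Perm (Fin b)) {M : Type*} [AddCommMonoid M] (f : ℕ → M) :
    ∑ a ∈ range b, f (permVal σ a) = ∑ a ∈ range b, f a := by
  rw [Finset.sum_range, Finset.sum_range]
  simp only [permVal_fin]
  exact Equiv.sum_comp σ fun k : Fin b => f k

/-- Number of `a < r` with `σ(a) < h`. -/
def below {b : ℕ} (σ : Equiv.Perm (Fin b)) (h r : ℕ) : ℝ :=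
  ∑ a ∈ range r, if permVal σ a < h then 1 else 0

/-- Number of `a < r` with `σ(a) = h`. -/
def hits {b : ℕ} (σ : Equiv.Perm (Fin b)) (h r : ℕ) : ℕ :=
  ∑ a ∈ range r, if permVal σ a = h then 1 else 0

/-- The local discrepancy of the permutation `σ`, which is `φ_{b,h}^σ(r/b)`. -/
def permDisc {b : ℕ} (σ : Equiv.Perm (Fin b)) (h r : ℕ) : ℝ :=
  below σ h r - (h : ℝ) * r / b

lemma below_succ_left {b : ℕ} (σ : Equiv.Perm (Fin b)) (h r : ℕ) :
    below σ (h + 1) r = below σ h r + hits σ h r := by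
  unfold below hits
  push_cast
  rw [← Finset.sum_add_distrib]
  refine Finset.sum_congr rfl fun a _ => ?_
  rcases lt_trichotomy (permVal σ a) h with h1 | h1 | h1
  · simp [h1, h1.ne, Nat.lt_succ_of_lt h1]
  · simp [h1]
  · simp [h1.ne', h1.not_gt, show ¬ permVal σ a < h + 1 by omega]

lemma below_succ_right {b : ℕ} (σ : Equiv.Perm (Fin b)) (h r : ℕ) :
    below σ h (r + 1) = below σ h r + if permVal σ r < h then 1 else 0 := by
  unfold below
  rw [Finset.sum_range_succ]

lemma hits_top {b : ℕ} (σ : Equiv.Perm (Fin b)) {h : ℕ} (hh : h < b) : hits σ h b = 1 := by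
  unfold hits
  rw [sum_permVal σ fun k => if k = h then 1 else 0]
  simp [hh]

lemma hits_le_one {b : ℕ} (σ : Equiv.Perm (Fin b)) {h r : ℕ} (hh : h < b) (hr : r ≤ b) :
    hits σ h r ≤ 1 := by
  rw [← hits_top σ hh]
  exact Finset.sum_le_sum_of_subset (Finset.range_subset_range.2 hr)

lemma sum_ite_lt {b h : ℕ} (hh : h ≤ b) :
    ∑ a ∈ range b, (if a < h then (1 : ℝ) else 0) = h := by
  rw [← Finset.sum_filter, show (range b).filter (· < h) = range h by ext; simp; omega]
  simp

lemma below_top {b : ℕ} (σ : Equiv.Perm (Fin b)) {h : ℕ} (hh : h ≤ b) : below σ h b = h := by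
  unfold below
  rw [sum_permVal σ fun k => if k < h then (1 : ℝ) else 0, sum_ite_lt hh]

lemma below_all {b : ℕ} (hb : 0 < b) (σ : Equiv.Perm (Fin b)) (r : ℕ) : below σ b r = r := by
  simp [below, permVal_lt hb]

lemma permDisc_zero_left {b : ℕ} (σ : Equiv.Perm (Fin b)) (r : ℕ) : permDisc σ 0 r = 0 := by
  simp [permDisc, below]

lemma permDisc_zero_right {b : ℕ} (σ : Equiv.Perm (Fin b)) (h : ℕ) : permDisc σ h 0 = 0 := by
  simp [permDisc, below]

lemma permDisc_top_left {b : ℕ} (hb : 0 < b) (σ : Equiv.Perm (Fin b)) (r : ℕ) :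
    permDisc σ b r = 0 := by
  have : (b : ℝ) ≠ 0 := by positivity
  rw [permDisc, below_all hb]
  field_simp
  ring

lemma permDisc_top_right {b : ℕ} (hb : 0 < b) (σ : Equiv.Perm (Fin b)) {h : ℕ} (hh : h ≤ b) :
    permDisc σ h b = 0 := by
  have : (b : ℝ) ≠ 0 := by positivity
  rw [permDisc, below_top σ hh]
  field_simp
  ring

lemma permDisc_succ_left {b : ℕ} (σ : Equiv.Perm (Fin b)) (h r : ℕ) :
    permDisc σ (h + 1) r = permDisc σ h r + (hits σ h r - (r : ℝ) / b) := by
  rw [permDisc, permDisc, below_succ_left]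
  push_cast
  ring

lemma permDisc_succ_right {b : ℕ} (σ : Equiv.Perm (Fin b)) (h r : ℕ) :
    permDisc σ h (r + 1) =
      permDisc σ h r + ((if permVal σ r < h then 1 else 0) - (h : ℝ) / b) := by
  rw [permDisc, permDisc, below_succ_right]
  push_cast
  ring

lemma sum_hits {b : ℕ} (hb : 0 < b) (σ : Equiv.Perm (Fin b)) (r : ℕ) :
    ∑ h ∈ range b, (hits σ h r : ℝ) = r := by
  have h1 : ∀ h, (hits σ h r : ℝ) = below σ (h + 1) r - below σ h r := fun h => by
    rw [below_succ_left]; ring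
  simp only [h1]
  rw [Finset.sum_range_sub (fun h => below σ h r), below_all hb]
  simp [below]

/-- Summation by parts for sequences vanishing at both ends. -/
lemma sum_mul_sub_of_ends (u : ℕ → ℝ) (m : ℕ) (h0 : u 0 = 0) (hm : u m = 0) :
    ∑ k ∈ range m, u k * (u (k + 1) - u k) = -(1 / 2) * ∑ k ∈ range m, (u (k + 1) - u k) ^ 2 := by
  have h1 := Finset.sum_range_sub (fun k => u k ^ 2) m
  rw [hm, h0] at h1
  rw [Finset.mul_sum, ← sub_eq_zero, ← Finset.sum_sub_distrib]
  have h2 : ∀ k, u k * (u (k + 1) - u k) - -(1 / 2) * (u (k + 1) - u k) ^ 2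
      = 1 / 2 * (u (k + 1) ^ 2 - u k ^ 2) := fun k => by ring
  simp only [h2]
  rw [← Finset.mul_sum, h1]
  ring

lemma sum_shift_of_ends {u : ℕ → ℝ} {m : ℕ} (h : u 0 = u m) :
    ∑ k ∈ range m, u (k + 1) = ∑ k ∈ range m, u k := by
  have h1 := Finset.sum_range_succ u m
  rw [Finset.sum_range_succ', h] at h1
  linarith

lemma sum_hits_sub_sq {b : ℕ} (hb : 0 < b) (σ : Equiv.Perm (Fin b)) {r : ℕ} (hr : r ≤ b) :
    ∑ h ∈ range b, ((hits σ h r : ℝ) - r / b) ^ 2 = r - (r : ℝ) ^ 2 / b := by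
  have hb' : (b : ℝ) ≠ 0 := by positivity
  have h1 : ∀ h ∈ range b, ((hits σ h r : ℝ) - r / b) ^ 2
      = (hits σ h r : ℝ) * (1 - 2 * (r / b)) + (r / b : ℝ) ^ 2 := fun h hh => by
    have h2 := hits_le_one σ (Finset.mem_range.1 hh) hr
    interval_cases hits σ h r <;> push_cast <;> ring
  rw [Finset.sum_congr rfl h1, Finset.sum_add_distrib, ← Finset.sum_mul, sum_hits hb]
  simp
  field_simp
  ring

lemma sum_ite_sub_sq {b : ℕ} (hb : 0 < b) (σ : Equiv.Perm (Fin b)) {h : ℕ} (hh : h ≤ b) :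
    ∑ r ∈ range b, ((if permVal σ r < h then (1 : ℝ) else 0) - h / b) ^ 2
      = h - (h : ℝ) ^ 2 / b := by
  have hb' : (b : ℝ) ≠ 0 := by positivity
  have h1 : ∀ r ∈ range b, ((if permVal σ r < h then (1 : ℝ) else 0) - h / b) ^ 2
      = (if permVal σ r < h then (1 : ℝ) else 0) * (1 - 2 * (h / b)) + (h / b : ℝ) ^ 2 :=
    fun r _ => by split_ifs <;> ring
  have h2 := below_top σ hh
  unfold below at h2
  rw [Finset.sum_congr rfl h1, Finset.sum_add_distrib, ← Finset.sum_mul, h2]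
  simp
  field_simp
  ring

lemma sum_range_id_real (m : ℕ) : ∑ k ∈ range m, (k : ℝ) = m * (m - 1) / 2 := by
  induction m with
  | zero => simp
  | succ m ih => rw [Finset.sum_range_succ, ih]; push_cast; ring

lemma sum_range_sq_real (m : ℕ) :
    ∑ k ∈ range m, (k : ℝ) ^ 2 = m * (m - 1) * (2 * m - 1) / 6 := by
  induction m with
  | zero => simp
  | succ m ih => rw [Finset.sum_range_succ, ih]; push_cast; ring

lemma sum_sub_sq_div {b : ℕ} (hb : 0 < b) :
    ∑ r ∈ range b, ((r : ℝ) - (r : ℝ) ^ 2 / b) = ((b : ℝ) ^ 2 - 1) / 6 := by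
  have hb' : (b : ℝ) ≠ 0 := by positivity
  rw [Finset.sum_sub_distrib, ← Finset.sum_div, sum_range_id_real, sum_range_sq_real]
  field_simp
  ring

lemma permVal_pbar {b : ℕ} (σ : Equiv.Perm (Fin b)) {a : ℕ} (ha : a < b) :
    permVal (pbar σ) a = b - 1 - permVal σ a := by
  simp [permVal, ha, pbar, tauP, Fin.val_rev]
  omega

lemma permDisc_pbar {b : ℕ} (hb : 0 < b) (σ : Equiv.Perm (Fin b)) {h r : ℕ} (hh : h ≤ b)
    (hr : r ≤ b) : permDisc (pbar σ) h r = -permDisc σ (b - h) r := by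
  have hb' : (b : ℝ) ≠ 0 := by positivity
  have h1 : below (pbar σ) h r = r - below σ (b - h) r := by
    rw [eq_sub_iff_add_eq]
    unfold below
    rw [← Finset.sum_add_distrib]
    trans ∑ a ∈ range r, (1 : ℝ)
    · refine Finset.sum_congr rfl fun a ha => ?_
      rw [permVal_pbar σ (by have := Finset.mem_range.1 ha; omega)]
      have := permVal_lt hb σ a
      by_cases h2 : permVal σ a < b - h
      · simp [h2, show ¬ b - 1 - permVal σ a < h by omega]
      · simp [h2, show b - 1 - permVal σ a < h by omega]
    · simp
  rw [permDisc, permDisc, h1, Nat.cast_sub hh]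
  field_simp
  ring

/-- `∑_{h,r} φ_{b,h}^σ(r/b)`. -/
def discSum {b : ℕ} (σ : Equiv.Perm (Fin b)) : ℝ :=
  ∑ h ∈ range b, ∑ r ∈ range b, permDisc σ h r

/-- `∑_{h,r} φ_{b,h}^σ(r/b)²`. -/
def discSqSum {b : ℕ} (σ : Equiv.Perm (Fin b)) : ℝ :=
  ∑ h ∈ range b, ∑ r ∈ range b, permDisc σ h r ^ 2

lemma sum_range_reflect_of_ends {u : ℕ → ℝ} {m : ℕ} (h : u 0 = u m) :
    ∑ k ∈ range m, u (m - k) = ∑ k ∈ range m, u k := by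
  have h1 := Finset.sum_range_reflect u (m + 1)
  rw [Finset.sum_range_succ, Finset.sum_range_succ] at h1
  simp at h1
  rw [h] at h1
  linarith

lemma discSum_pbar {b : ℕ} (hb : 0 < b) (σ : Equiv.Perm (Fin b)) :
    discSum (pbar σ) = -discSum σ := by
  unfold discSum
  rw [← sum_range_reflect_of_ends (u := fun h => ∑ r ∈ range b, permDisc σ h r)
    (by simp [permDisc_zero_left, permDisc_top_left hb]), ← Finset.sum_neg_distrib]
  refine Finset.sum_congr rfl fun h hh => ?_
  rw [← Finset.sum_neg_distrib]
  exact Finset.sum_congr rfl fun r hr =>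
    permDisc_pbar hb σ (Finset.mem_range.1 hh).le (Finset.mem_range.1 hr).le

lemma discSqSum_pbar {b : ℕ} (hb : 0 < b) (σ : Equiv.Perm (Fin b)) :
    discSqSum (pbar σ) = discSqSum σ := by
  unfold discSqSum
  rw [← sum_range_reflect_of_ends (u := fun h => ∑ r ∈ range b, permDisc σ h r ^ 2)
    (by simp [permDisc_zero_left, permDisc_top_left hb])]
  refine Finset.sum_congr rfl fun h hh => Finset.sum_congr rfl fun r hr => ?_
  rw [permDisc_pbar hb σ (Finset.mem_range.1 hh).le (Finset.mem_range.1 hr).le, neg_sq]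

lemma sum_range_mul_split {M : Type*} [AddCommMonoid M] (f : ℕ → M) (m k : ℕ) :
    ∑ i ∈ range (m * k), f i = ∑ q ∈ range k, ∑ r ∈ range m, f (m * q + r) := by
  induction k with
  | zero => simp
  | succ k ih => rw [Nat.mul_succ, Finset.sum_range_add, ih, Finset.sum_range_succ]

/-- The digit-scrambled radical inverse: maps `∑ a_j b^{n-1-j}` to `∑ σ_j(a_j) b^j`. -/
def scramble {b : ℕ} (T : ℕ → Equiv.Perm (Fin b)) : ℕ → ℕ → ℕ
  | 0, _ => 0
  | n + 1, Y => permVal (T n) (Y % b) * b ^ n + scramble T n (Y / b)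

lemma scramble_succ {b : ℕ} (T : ℕ → Equiv.Perm (Fin b)) (n q : ℕ) {a : ℕ} (ha : a < b) :
    scramble T (n + 1) (b * q + a) = permVal (T n) a * b ^ n + scramble T n q := by
  have hb : 0 < b := by omega
  rw [scramble, Nat.mul_add_mod, Nat.mod_eq_of_lt ha, Nat.mul_add_div hb, Nat.div_eq_of_lt ha,
    add_zero]

lemma scramble_lt {b : ℕ} (hb : 0 < b) (T : ℕ → Equiv.Perm (Fin b)) (n Y : ℕ) :
    scramble T n Y < b ^ n := by
  induction n generalizing Y with
  | zero => simp [scramble]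
  | succ n ih =>
    rw [scramble, pow_succ]
    have h1 := ih (Y / b)
    have h2 : permVal (T n) (Y % b) + 1 ≤ b := permVal_lt hb _ _
    nlinarith [Nat.mul_le_mul_right (b ^ n) h2]

lemma sum_scramble {b : ℕ} (T : ℕ → Equiv.Perm (Fin b)) {M : Type*} [AddCommMonoid M] (n : ℕ)
    (f : ℕ → M) : ∑ Y ∈ range (b ^ n), f (scramble T n Y) = ∑ k ∈ range (b ^ n), f k := by
  induction n generalizing f with
  | zero => simp [scramble]
  | succ n ih =>
    rw [pow_succ, sum_range_mul_split f, mul_comm, sum_range_mul_split, Finset.sum_comm]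
    rw [← sum_permVal (T n) fun a => ∑ r ∈ range (b ^ n), f (b ^ n * a + r)]
    refine Finset.sum_congr rfl fun a ha => ?_
    rw [← ih fun k => f (b ^ n * permVal (T n) a + k)]
    refine Finset.sum_congr rfl fun q _ => ?_
    rw [scramble_succ T n q (Finset.mem_range.1 ha), mul_comm]

/-- Number of points of the scaled point set in `[0,lam) × [0,M)`. -/
def gridCount {b : ℕ} (T : ℕ → Equiv.Perm (Fin b)) (n lam M : ℕ) : ℝ :=
  ∑ Y ∈ range M, if scramble T n Y < lam then 1 else 0

/-- Local discrepancy at `(lam/bⁿ, M/bⁿ)`. -/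
def gridDisc {b : ℕ} (T : ℕ → Equiv.Perm (Fin b)) (n lam M : ℕ) : ℝ :=
  gridCount T n lam M - (lam : ℝ) * M / b ^ n

lemma gridDisc_zero_left {b : ℕ} (T : ℕ → Equiv.Perm (Fin b)) (n M : ℕ) :
    gridDisc T n 0 M = 0 := by simp [gridDisc, gridCount]

lemma gridDisc_zero_right {b : ℕ} (T : ℕ → Equiv.Perm (Fin b)) (n lam : ℕ) :
    gridDisc T n lam 0 = 0 := by simp [gridDisc, gridCount]

lemma gridDisc_top_left {b : ℕ} (hb : 0 < b) (T : ℕ → Equiv.Perm (Fin b)) (n M : ℕ) :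
    gridDisc T n (b ^ n) M = 0 := by
  have : (b : ℝ) ≠ 0 := by positivity
  simp [gridDisc, gridCount, scramble_lt hb]
  field_simp
  ring

lemma gridCount_top_right {b : ℕ} (T : ℕ → Equiv.Perm (Fin b)) (n : ℕ) {lam : ℕ}
    (h : lam ≤ b ^ n) : gridCount T n lam (b ^ n) = lam := by
  rw [gridCount, sum_scramble T n fun k => if k < lam then (1 : ℝ) else 0, sum_ite_lt h]

lemma gridDisc_top_right {b : ℕ} (hb : 0 < b) (T : ℕ → Equiv.Perm (Fin b)) (n : ℕ) {lam : ℕ}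
    (h : lam ≤ b ^ n) : gridDisc T n lam (b ^ n) = 0 := by
  have : (b : ℝ) ≠ 0 := by positivity
  rw [gridDisc, gridCount_top_right T n h]
  push_cast
  field_simp
  ring

lemma indicator_scramble_succ {b : ℕ} (hb : 0 < b) (T : ℕ → Equiv.Perm (Fin b)) {n q a h mu : ℕ}
    (ha : a < b) (hmu : mu < b ^ n) :
    (if scramble T (n + 1) (b * q + a) < h * b ^ n + mu then (1 : ℝ) else 0)
      = (if permVal (T n) a < h then 1 else 0)
        + (if permVal (T n) a = h then 1 else 0) * (if scramble T n q < mu then 1 else 0) := by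
  rw [scramble_succ T n q ha]
  have h1 := scramble_lt hb T n q
  rcases lt_trichotomy (permVal (T n) a) h with h2 | h2 | h2
  · have h3 := Nat.mul_le_mul_right (b ^ n) (Nat.succ_le_of_lt h2)
    rw [Nat.succ_mul] at h3
    simp [h2, h2.ne, show permVal (T n) a * b ^ n + scramble T n q < h * b ^ n + mu by omega]
  · simp [h2]
  · have h3 := Nat.mul_le_mul_right (b ^ n) (Nat.succ_le_of_lt h2)
    rw [Nat.succ_mul] at h3
    simp [h2.ne', h2.not_gt,
      show ¬ permVal (T n) a * b ^ n + scramble T n q < h * b ^ n + mu by omega]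

lemma gridCount_succ {b : ℕ} (hb : 0 < b) (T : ℕ → Equiv.Perm (Fin b)) {n h mu r : ℕ} (q : ℕ)
    (hh : h < b) (hmu : mu < b ^ n) (hr : r < b) :
    gridCount T (n + 1) (h * b ^ n + mu) (b * q + r)
      = h * q + below (T n) h r + gridCount T n mu (q + hits (T n) h r) := by
  have block : ∀ q' m, m ≤ b →
      (∑ a ∈ range m,
        if scramble T (n + 1) (b * q' + a) < h * b ^ n + mu then (1 : ℝ) else 0)
        = below (T n) h m + hits (T n) h m * (if scramble T n q' < mu then 1 else 0) := by
    intro q' m hm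
    rw [Finset.sum_congr rfl fun a ha => indicator_scramble_succ hb T
      (lt_of_lt_of_le (Finset.mem_range.1 ha) hm) hmu, Finset.sum_add_distrib, ← Finset.sum_mul]
    simp [below, hits]
  rw [gridCount, Finset.sum_range_add, sum_range_mul_split, block q r hr.le]
  simp only [block _ b le_rfl, below_top (T n) hh.le, hits_top (T n) hh]
  rw [Finset.sum_add_distrib]
  have h1 := hits_le_one (T n) hh hr.le
  interval_cases hits (T n) h r
  · simp [gridCount]; ring
  · simp only [gridCount, Finset.sum_range_succ, Finset.sum_const, Finset.card_range,
      nsmul_eq_mul, Nat.cast_one, one_mul]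
    ring

lemma gridDisc_succ {b : ℕ} (hb : 0 < b) (T : ℕ → Equiv.Perm (Fin b)) {n h mu r : ℕ} (q : ℕ)
    (hh : h < b) (hmu : mu < b ^ n) (hr : r < b) :
    gridDisc T (n + 1) (h * b ^ n + mu) (b * q + r)
      = gridDisc T n mu (q + hits (T n) h r)
        + (permDisc (T n) h r + mu / (b : ℝ) ^ n * (hits (T n) h r - r / b)) := by
  have : (b : ℝ) ≠ 0 := by positivity
  rw [gridDisc, gridDisc, gridCount_succ hb T q hh hmu hr, permDisc]
  push_cast
  field_simp
  ring

lemma sum_gridDisc_shift {b : ℕ} (hb : 0 < b) (T : ℕ → Equiv.Perm (Fin b)) {n mu e : ℕ}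
    (hmu : mu ≤ b ^ n) (he : e ≤ 1) (p : ℝ → ℝ) :
    ∑ q ∈ range (b ^ n), p (gridDisc T n mu (q + e))
      = ∑ q ∈ range (b ^ n), p (gridDisc T n mu q) := by
  interval_cases e
  · rfl
  · exact sum_shift_of_ends (u := fun q => p (gridDisc T n mu q))
      (by simp [gridDisc_zero_right, gridDisc_top_right hb T n hmu])

lemma scramble_reflect {b : ℕ} (T : ℕ → Equiv.Perm (Fin b))
    (hT : ∀ j, ∀ a < b, permVal (T j) (b - 1 - a) = b - 1 - permVal (T j) a) (n : ℕ) {Y : ℕ}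
    (hY : Y < b ^ n) : scramble T n (b ^ n - 1 - Y) = b ^ n - 1 - scramble T n Y := by
  induction n generalizing Y with
  | zero => simp [scramble]
  | succ n ih =>
    rcases Nat.eq_zero_or_pos b with rfl | hb
    · simp at hY
    have ha : Y % b < b := Nat.mod_lt _ hb
    have hq : Y / b < b ^ n := by
      rw [Nat.div_lt_iff_lt_mul hb, ← pow_succ]; exact hY
    have e : b * (Y / b) + Y % b = Y := Nat.div_add_mod Y b
    generalize Y % b = a at *
    generalize Y / b = q at *
    subst e
    have h1 : b ^ (n + 1) - 1 - (b * q + a) = b * (b ^ n - 1 - q) + (b - 1 - a) := by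
      obtain ⟨q', h2⟩ : ∃ q', b ^ n = q + q' + 1 := ⟨b ^ n - 1 - q, by omega⟩
      obtain ⟨a', h3⟩ : ∃ a', b = a + a' + 1 := ⟨b - 1 - a, by omega⟩
      have h4 : b ^ n - 1 - q = q' := by omega
      have h5 : b - 1 - a = a' := by omega
      have h6 : b ^ (n + 1) = b * q + b * q' + b := by rw [pow_succ, h2]; ring
      rw [h4, h5]
      omega
    rw [h1, scramble_succ T n _ (by omega), scramble_succ T n _ ha, hT n a ha, ih hq]
    have h2 := permVal_lt hb (T n) a
    have h3 := scramble_lt hb T n q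
    generalize permVal (T n) a = s at *
    generalize scramble T n q = x at *
    obtain ⟨s', rfl⟩ : ∃ s', b = s + s' + 1 := ⟨b - 1 - s, by omega⟩
    have h5 : s + s' + 1 - 1 - s = s' := by omega
    rw [h5, pow_succ]
    generalize (s + s' + 1) ^ n = K at *
    have : K * (s + s' + 1) = s * K + s' * K + K := by ring
    omega

lemma gridCount_eq_sum {b : ℕ} (T : ℕ → Equiv.Perm (Fin b)) (n lam : ℕ) {M : ℕ}
    (hM : M ≤ b ^ n) : gridCount T n lam M =
      ∑ Y ∈ range (b ^ n),
        (if Y < M then (1 : ℝ) else 0) * (if scramble T n Y < lam then 1 else 0) := by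
  simp only [ite_mul, one_mul, zero_mul]
  rw [← Finset.sum_filter, show (range (b ^ n)).filter (· < M) = range M by ext; simp; omega]
  rfl

lemma gridDisc_reflect {b : ℕ} (hb : 0 < b) (T : ℕ → Equiv.Perm (Fin b))
    (hT : ∀ j, ∀ a < b, permVal (T j) (b - 1 - a) = b - 1 - permVal (T j) a) {n lam M : ℕ}
    (hlam : lam ≤ b ^ n) (hM : M ≤ b ^ n) :
    gridDisc T n (b ^ n - lam) (b ^ n - M) = gridDisc T n lam M := by
  have hb' : (b : ℝ) ≠ 0 := by positivity
  have h1 : gridCount T n (b ^ n - lam) (b ^ n - M)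
      = (b : ℝ) ^ n - M - lam + gridCount T n lam M := by
    have h3 := gridCount_top_right T n hlam
    rw [gridCount] at h3
    have h4 := sum_ite_lt hM
    rw [gridCount_eq_sum T n _ (Nat.sub_le _ _), ← Finset.sum_range_reflect,
      gridCount_eq_sum T n _ hM]
    conv_rhs => rw [← h3, ← h4, show (b : ℝ) ^ n = ∑ Y ∈ range (b ^ n), (1 : ℝ) by simp]
    rw [← Finset.sum_sub_distrib, ← Finset.sum_sub_distrib, ← Finset.sum_add_distrib]
    refine Finset.sum_congr rfl fun Y hY => ?_
    have hY := Finset.mem_range.1 hY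
    rw [scramble_reflect T hT n hY]
    have h5 := scramble_lt hb T n Y
    have h6 : (b ^ n - 1 - Y < b ^ n - M) ↔ ¬ Y < M := by omega
    have h7 : (b ^ n - 1 - scramble T n Y < b ^ n - lam) ↔ ¬ scramble T n Y < lam := by omega
    simp only [h6, h7]
    by_cases h8 : Y < M <;> by_cases h9 : scramble T n Y < lam <;> simp [h8, h9]
  rw [gridDisc, gridDisc, h1, Nat.cast_sub hlam, Nat.cast_sub hM]
  push_cast
  field_simp
  ring

/-- `φ_{b,h}^σ` interpolated from `h/b` towards `(h+1)/b`. -/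
def interpDisc {b : ℕ} (σ : Equiv.Perm (Fin b)) (t : ℝ) (h r : ℕ) : ℝ :=
  permDisc σ h r + t * (hits σ h r - r / b)

lemma sum_interpDisc {b : ℕ} (hb : 0 < b) (σ : Equiv.Perm (Fin b)) (t : ℝ) :
    ∑ h ∈ range b, ∑ r ∈ range b, interpDisc σ t h r = discSum σ := by
  have hb' : (b : ℝ) ≠ 0 := by positivity
  unfold discSum interpDisc
  rw [Finset.sum_comm, Finset.sum_comm (f := fun h r => permDisc σ h r)]
  refine Finset.sum_congr rfl fun r _ => ?_
  rw [Finset.sum_add_distrib, ← Finset.mul_sum, Finset.sum_sub_distrib, sum_hits hb]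
  simp
  right
  field_simp
  ring

lemma sum_interpDisc_sq {b : ℕ} (hb : 0 < b) (σ : Equiv.Perm (Fin b)) (t : ℝ) :
    ∑ h ∈ range b, ∑ r ∈ range b, interpDisc σ t h r ^ 2
      = discSqSum σ + (t ^ 2 - t) * (((b : ℝ) ^ 2 - 1) / 6) := by
  unfold discSqSum
  rw [Finset.sum_comm, Finset.sum_comm (f := fun h r => permDisc σ h r ^ 2), ← sum_sub_sq_div hb,
    Finset.mul_sum, ← Finset.sum_add_distrib]
  refine Finset.sum_congr rfl fun r hr => ?_
  have h1 := sum_mul_sub_of_ends (fun h => permDisc σ h r) b (permDisc_zero_left σ r)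
    (permDisc_top_left hb σ r)
  simp only [permDisc_succ_left, add_sub_cancel_left] at h1
  have h2 := sum_hits_sub_sq hb σ (Finset.mem_range.1 hr).le
  rw [h2] at h1
  have h3 : ∀ h, interpDisc σ t h r ^ 2 = permDisc σ h r ^ 2
      + 2 * t * (permDisc σ h r * (hits σ h r - r / b))
      + t ^ 2 * ((hits σ h r : ℝ) - r / b) ^ 2 := fun h => by unfold interpDisc; ring
  simp only [h3]
  rw [Finset.sum_add_distrib, Finset.sum_add_distrib, ← Finset.mul_sum, ← Finset.mul_sum, h1, h2]
  ring

lemma sum_comp_gridDisc_succ {b : ℕ} (hb : 0 < b) (T : ℕ → Equiv.Perm (Fin b)) (n : ℕ)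
    (p : ℝ → ℝ) :
    ∑ lam ∈ range (b ^ (n + 1)), ∑ M ∈ range (b ^ (n + 1)), p (gridDisc T (n + 1) lam M)
      = ∑ mu ∈ range (b ^ n), ∑ h ∈ range b, ∑ r ∈ range b, ∑ q ∈ range (b ^ n),
          p (gridDisc T n mu q + interpDisc (T n) (mu / (b : ℝ) ^ n) h r) := by
  rw [pow_succ, sum_range_mul_split, Finset.sum_comm]
  refine Finset.sum_congr rfl fun mu hmu => Finset.sum_congr rfl fun h hh => ?_
  rw [mul_comm (b ^ n) b, sum_range_mul_split, Finset.sum_comm]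
  refine Finset.sum_congr rfl fun r hr => ?_
  rw [Finset.mem_range] at hmu hh hr
  rw [← sum_gridDisc_shift hb T hmu.le (hits_le_one (T n) hh hr.le)
    fun x => p (x + interpDisc (T n) (mu / (b : ℝ) ^ n) h r)]
  refine Finset.sum_congr rfl fun q _ => ?_
  rw [mul_comm (b ^ n) h, gridDisc_succ hb T q hh hmu hr, interpDisc]

/-- Sum of the local discrepancy over the grid. -/
def gridSum {b : ℕ} (T : ℕ → Equiv.Perm (Fin b)) (n : ℕ) : ℝ :=
  ∑ lam ∈ range (b ^ n), ∑ M ∈ range (b ^ n), gridDisc T n lam M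

/-- Sum of the squared local discrepancy over the grid. -/
def gridSqSum {b : ℕ} (T : ℕ → Equiv.Perm (Fin b)) (n : ℕ) : ℝ :=
  ∑ lam ∈ range (b ^ n), ∑ M ∈ range (b ^ n), gridDisc T n lam M ^ 2

lemma gridSum_succ {b : ℕ} (hb : 0 < b) (T : ℕ → Equiv.Perm (Fin b)) (n : ℕ) :
    gridSum T (n + 1) = (b : ℝ) ^ 2 * gridSum T n + ((b : ℝ) ^ n) ^ 2 * discSum (T n) := by
  rw [gridSum, sum_comp_gridDisc_succ hb T n fun x => x]
  simp only [Finset.sum_add_distrib, Finset.sum_const, Finset.card_range, nsmul_eq_mul,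
    ← Finset.mul_sum, sum_interpDisc hb, gridSum]
  push_cast
  ring

lemma gridSqSum_succ {b : ℕ} (hb : 0 < b) (T : ℕ → Equiv.Perm (Fin b)) (n : ℕ) :
    gridSqSum T (n + 1) = (b : ℝ) ^ 2 * gridSqSum T n + 2 * discSum (T n) * gridSum T n
      + ((b : ℝ) ^ n) ^ 2 * discSqSum (T n)
      - (((b : ℝ) ^ n) ^ 2 - 1) * ((b : ℝ) ^ 2 - 1) / 36 := by
  have hb' : (b : ℝ) ≠ 0 := by positivity
  rw [gridSqSum, sum_comp_gridDisc_succ hb T n fun x => x ^ 2]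
  have h1 : ∀ mu : ℕ, ∑ h ∈ range b, ∑ r ∈ range b, ∑ q ∈ range (b ^ n),
      (gridDisc T n mu q + interpDisc (T n) (mu / (b : ℝ) ^ n) h r) ^ 2
      = (b : ℝ) ^ 2 * ∑ q ∈ range (b ^ n), gridDisc T n mu q ^ 2
        + 2 * discSum (T n) * ∑ q ∈ range (b ^ n), gridDisc T n mu q
        + (b : ℝ) ^ n * (discSqSum (T n)
          + (((mu : ℝ) ^ 2) / ((b : ℝ) ^ n) ^ 2 - mu / (b : ℝ) ^ n)
            * (((b : ℝ) ^ 2 - 1) / 6)) := fun mu => by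
    rw [← div_pow, ← sum_interpDisc_sq hb, ← sum_interpDisc hb (T n) (mu / (b : ℝ) ^ n)]
    simp only [add_sq, Finset.sum_add_distrib, Finset.sum_const, Finset.card_range, nsmul_eq_mul,
      ← Finset.mul_sum, ← Finset.sum_mul]
    push_cast
    ring
  simp only [h1, Finset.sum_add_distrib, ← Finset.mul_sum, ← Finset.sum_mul,
    Finset.sum_sub_distrib, ← Finset.sum_div, sum_range_sq_real, sum_range_id_real,
    Finset.sum_const, Finset.card_range, nsmul_eq_mul, gridSum, gridSqSum]
  push_cast
  field_simp
  ring

lemma sum_gridDisc_mul_add {b : ℕ} (hb : 0 < b) (T : ℕ → Equiv.Perm (Fin b))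
    (hT : ∀ j, ∀ a < b, permVal (T j) (b - 1 - a) = b - 1 - permVal (T j) a) (n : ℕ) :
    ∑ lam ∈ range (b ^ n), ∑ M ∈ range (b ^ n), gridDisc T n lam M * ((lam : ℝ) + M)
      = (b : ℝ) ^ n * gridSum T n := by
  set f : ℕ → ℕ → ℝ := fun lam M => gridDisc T n lam M * ((lam : ℝ) + M)
  set g : ℕ → ℕ → ℝ := fun lam M =>
    gridDisc T n lam M * (2 * (b : ℝ) ^ n - ((lam : ℝ) + M))
  have h1 : ∑ lam ∈ range (b ^ n), ∑ M ∈ range (b ^ n), f lam M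
      = ∑ lam ∈ range (b ^ n), ∑ M ∈ range (b ^ n), g lam M := by
    rw [← sum_range_reflect_of_ends (u := fun lam => ∑ M ∈ range (b ^ n), f lam M)
      (by simp [f, gridDisc_zero_left, gridDisc_top_left hb])]
    refine Finset.sum_congr rfl fun lam hlam => ?_
    have hlam := (Finset.mem_range.1 hlam).le
    rw [← sum_range_reflect_of_ends (u := fun M => f (b ^ n - lam) M)
      (by simp [f, gridDisc_zero_right, gridDisc_top_right hb])]
    refine Finset.sum_congr rfl fun M hM => ?_
    have hM := (Finset.mem_range.1 hM).le
    simp only [f, g]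
    rw [gridDisc_reflect hb T hT hlam hM, Nat.cast_sub hlam, Nat.cast_sub hM]
    push_cast
    ring
  have h2 : ∑ lam ∈ range (b ^ n), ∑ M ∈ range (b ^ n), (f lam M + g lam M)
      = 2 * (b : ℝ) ^ n * gridSum T n := by
    have h3 : ∀ lam M, f lam M + g lam M = 2 * (b : ℝ) ^ n * gridDisc T n lam M :=
      fun lam M => by simp only [f, g]; ring
    simp only [h3, ← Finset.mul_sum, gridSum]
  simp only [Finset.sum_add_distrib, ← h1] at h2
  linarith

lemma integral_piecewise {m : ℕ} (hm : 0 < m) {f : ℝ → ℝ} {p : ℕ → ℝ → ℝ}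
    (hp : ∀ k, Continuous (p k))
    (hf : ∀ k < m, ∀ x ∈ Set.Ioo ((k : ℝ) / m) (((k : ℝ) + 1) / m), f x = p k x) :
    ∫ x in (0:ℝ)..1, f x = ∑ k ∈ range m, ∫ x in ((k : ℝ) / m)..(((k : ℝ) + 1) / m), p k x := by
  have hm' : (m : ℝ) ≠ 0 := by positivity
  have hle : ∀ k : ℕ, (k : ℝ) / m ≤ ((k : ℝ) + 1) / m := fun k => by gcongr; linarith
  have hint : ∀ k < m, IntervalIntegrable f MeasureTheory.volume
      ((k : ℝ) / m) (((k + 1 : ℕ) : ℝ) / m) := fun k hk => by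
    rw [Nat.cast_succ]
    refine ((hp k).intervalIntegrable _ _).congr_uIoo fun x hx => ?_
    rw [Set.uIoo_of_le (hle k)] at hx
    exact (hf k hk x hx).symm
  have h1 := intervalIntegral.sum_integral_adjacent_intervals (a := fun k : ℕ => (k : ℝ) / m) hint
  simp only [Nat.cast_zero, zero_div, div_self hm', Nat.cast_succ] at h1
  rw [← h1]
  refine Finset.sum_congr rfl fun k hk => ?_
  exact intervalIntegral.integral_congr_Ioo_of_le (hle k) (hf k (Finset.mem_range.1 hk))

lemma integral_quadratic (c₀ c₁ c₂ u v : ℝ) :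
    ∫ x in u..v, (c₀ + c₁ * x + c₂ * x ^ 2)
      = c₀ * (v - u) + c₁ * ((v ^ 2 - u ^ 2) / 2) + c₂ * ((v ^ 3 - u ^ 3) / 3) := by
  rw [intervalIntegral.integral_add (Continuous.intervalIntegrable (by fun_prop) _ _)
      (Continuous.intervalIntegrable (by fun_prop) _ _),
    intervalIntegral.integral_add (Continuous.intervalIntegrable (by fun_prop) _ _)
      (Continuous.intervalIntegrable (by fun_prop) _ _),
    intervalIntegral.integral_const_mul, intervalIntegral.integral_const_mul, integral_id,
    integral_pow]
  simp
  norm_num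
  ring

lemma floor_toNat_eq {m k : ℕ} {x : ℝ}
    (hx : x ∈ Set.Ioo ((k : ℝ) / m) (((k : ℝ) + 1) / m)) (hm : 0 < m) :
    (⌊(m : ℝ) * x⌋).toNat = k := by
  have hm' : (0 : ℝ) < m := by positivity
  have h1 := (div_lt_iff₀ hm').1 hx.1
  have h2 := (lt_div_iff₀ hm').1 hx.2
  have : ⌊(m : ℝ) * x⌋ = (k : ℤ) := by
    rw [Int.floor_eq_iff]
    push_cast
    constructor <;> linarith
  simp [this]

lemma phi_eq_interp {b : ℕ} (hb : 0 < b) (σ : Equiv.Perm (Fin b)) {h r : ℕ} (hr : r < b)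
    {x : ℝ} (hx : x ∈ Set.Ioo ((r : ℝ) / b) (((r : ℝ) + 1) / b)) :
    phi σ h x = permDisc σ h r + (b * x - r) * (permDisc σ h (r + 1) - permDisc σ h r) := by
  have hb' : (0 : ℝ) < b := by positivity
  have h1 : Int.fract x = x := by
    rw [Int.fract_eq_self]
    refine ⟨le_trans (by positivity) hx.1.le, lt_of_lt_of_le hx.2 ?_⟩
    rw [div_le_one hb']
    exact_mod_cast hr
  have h2 : (((range (r + 1)).filter fun l => permVal σ l < h).card : ℝ) = below σ h (r + 1) := by
    rw [Finset.card_filter]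
    simp [below]
  have h3 : (((range (r + 1)).filter fun l => h ≤ permVal σ l).card : ℝ)
      = r + 1 - below σ h (r + 1) := by
    have h4 := Finset.card_filter_add_card_filter_not (s := range (r + 1))
      (fun l => permVal σ l < h)
    simp only [not_lt, Finset.card_range] at h4
    rw [← h2, eq_sub_iff_add_eq']
    exact_mod_cast h4
  rw [phi, h1, floor_toNat_eq hx hb, h2, h3, permDisc_succ_right, permDisc, below_succ_right]
  have h5 : (b : ℝ) ≠ 0 := hb'.ne'
  by_cases h6 : h ≤ permVal σ r
  · simp only [h6, if_true, not_lt.2 h6, if_false]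
    field_simp
    ring
  · simp only [h6, if_false, not_le.1 h6, if_true]
    field_simp
    ring

lemma PhiS_eq {b : ℕ} (hb : 0 < b) (σ : Equiv.Perm (Fin b)) :
    PhiS σ = discSum σ / (b : ℝ) ^ 2 := by
  have hb' : (b : ℝ) ≠ 0 := by positivity
  have h1 : ∫ x in (0:ℝ)..1, phiS σ x = ∑ r ∈ range b, ∑ h ∈ range b,
      (permDisc σ h r + permDisc σ h (r + 1)) / (2 * b) := by
    rw [integral_piecewise hb (f := phiS σ)
      (p := fun r x => ∑ h ∈ range b,
        (permDisc σ h r + (b * x - r) * (permDisc σ h (r + 1) - permDisc σ h r)))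
      (fun r => by fun_prop)
      fun r hr x hx => Finset.sum_congr rfl fun h _ => phi_eq_interp hb σ hr hx]
    refine Finset.sum_congr rfl fun r _ => ?_
    rw [intervalIntegral.integral_finsetSum
      fun h _ => Continuous.intervalIntegrable (by fun_prop) _ _]
    refine Finset.sum_congr rfl fun h _ => ?_
    generalize permDisc σ h (r + 1) = v
    generalize permDisc σ h r = u
    have h2 : ∀ x : ℝ, u + (b * x - r) * (v - u)
        = (u - r * (v - u)) + (b * (v - u)) * x + 0 * x ^ 2 := fun x => by ring
    simp only [h2, integral_quadratic]
    field_simp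
    ring
  rw [PhiS, h1, Finset.sum_comm, discSum, Finset.mul_sum, Finset.sum_div]
  refine Finset.sum_congr rfl fun h hh => ?_
  have h2 := sum_shift_of_ends (u := fun r => permDisc σ h r) (m := b)
    (by simp [permDisc_zero_right, permDisc_top_right hb σ (Finset.mem_range.1 hh).le])
  rw [← Finset.sum_div, Finset.sum_add_distrib, h2]
  field_simp
  ring

lemma PhiS2_eq {b : ℕ} (hb : 0 < b) (σ : Equiv.Perm (Fin b)) :
    PhiS2 σ = (discSqSum σ - ((b : ℝ) ^ 2 - 1) / 36) / (b : ℝ) ^ 2 := by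
  have hb' : (b : ℝ) ≠ 0 := by positivity
  have h1 : ∫ x in (0:ℝ)..1, phiS2 σ x = ∑ r ∈ range b, ∑ h ∈ range b,
      (permDisc σ h r ^ 2 + permDisc σ h r * (permDisc σ h (r + 1) - permDisc σ h r)
        + (permDisc σ h (r + 1) - permDisc σ h r) ^ 2 / 3) / b := by
    rw [integral_piecewise hb (f := phiS2 σ)
      (p := fun r x => ∑ h ∈ range b,
        (permDisc σ h r + (b * x - r) * (permDisc σ h (r + 1) - permDisc σ h r)) ^ 2)
      (fun r => by fun_prop)
      fun r hr x hx => Finset.sum_congr rfl fun h _ => by rw [phi_eq_interp hb σ hr hx]]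
    refine Finset.sum_congr rfl fun r _ => ?_
    rw [intervalIntegral.integral_finsetSum
      fun h _ => Continuous.intervalIntegrable (by fun_prop) _ _]
    refine Finset.sum_congr rfl fun h _ => ?_
    generalize permDisc σ h (r + 1) = v
    generalize permDisc σ h r = u
    have h2 : ∀ x : ℝ, (u + (b * x - r) * (v - u)) ^ 2
        = (u - r * (v - u)) ^ 2 + (2 * (u - r * (v - u)) * (b * (v - u))) * x
          + (b * (v - u)) ^ 2 * x ^ 2 := fun x => by ring
    simp only [h2, integral_quadratic]
    field_simp
    ring
  rw [PhiS2, h1, Finset.sum_comm, discSqSum]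
  have h3 : ((b : ℝ) ^ 2 - 1) / 36 = ∑ h ∈ range b, ((h : ℝ) - (h : ℝ) ^ 2 / b) / 6 := by
    rw [← Finset.sum_div, sum_sub_sq_div hb]; ring
  rw [h3, ← Finset.sum_sub_distrib, Finset.mul_sum, Finset.sum_div]
  refine Finset.sum_congr rfl fun h hh => ?_
  have hh := (Finset.mem_range.1 hh).le
  have h4 := sum_mul_sub_of_ends (fun r => permDisc σ h r) b (permDisc_zero_right σ h)
    (permDisc_top_right hb σ hh)
  have h5 := sum_ite_sub_sq hb σ hh
  have h6 : ∀ r, permDisc σ h (r + 1) - permDisc σ h r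
      = (if permVal σ r < h then 1 else 0) - (h : ℝ) / b := fun r => by
    rw [permDisc_succ_right]; ring
  simp only [h6] at h4 ⊢
  rw [← Finset.sum_div, Finset.sum_add_distrib, Finset.sum_add_distrib, h4, ← Finset.sum_div, h5]
  field_simp
  ring

lemma hammPt_snoc {b : ℕ} (hb : 0 < b) (T : ℕ → Equiv.Perm (Fin b)) (n : ℕ) (c : Fin b)
    (a : Fin n → Fin b) :
    hammPt b (n + 1) (fun i => T i) (Fin.snoc (α := fun _ => Fin b) a c)
      = ((hammPt b n (fun i => T i) a).1 / b + (T n c : ℕ) / (b : ℝ),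
        (hammPt b n (fun i => T i) a).2 + (c : ℕ) / (b : ℝ) ^ (n + 1)) := by
  have hb' : (b : ℝ) ≠ 0 := by positivity
  unfold hammPt
  rw [Prod.mk.injEq, Fin.sum_univ_castSucc, Fin.sum_univ_castSucc]
  constructor
  · simp only [Fin.snoc_castSucc, Fin.snoc_last, Fin.val_castSucc, Fin.val_last]
    rw [Finset.sum_div]
    congr 1
    · refine Finset.sum_congr rfl fun j _ => ?_
      rw [show n + 1 - (j : ℕ) = (n - j) + 1 by omega, pow_succ, div_div]
    · simp
  · simp only [Fin.snoc_castSucc, Fin.snoc_last, Fin.val_castSucc, Fin.val_last]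

lemma sum_hammPt {b : ℕ} (hb : 0 < b) (T : ℕ → Equiv.Perm (Fin b)) (n : ℕ) (f : ℝ × ℝ → ℝ) :
    ∑ a : Fin n → Fin b, f (hammPt b n (fun i => T i) a)
      = ∑ Y ∈ range (b ^ n), f ((scramble T n Y : ℝ) / b ^ n, (Y : ℝ) / b ^ n) := by
  have hb' : (b : ℝ) ≠ 0 := by positivity
  induction n generalizing f with
  | zero => simp [hammPt, scramble]
  | succ n ih =>
    rw [← Equiv.sum_comp (Fin.snocEquiv fun _ : Fin (n + 1) => Fin b)
        (fun a => f (hammPt b (n + 1) (fun i => T i) a)), Fintype.sum_prod_type,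
      pow_succ' b n, sum_range_mul_split]
    conv_rhs => rw [Finset.sum_comm, Finset.sum_range]
    refine Finset.sum_congr rfl fun c _ => ?_
    refine (Finset.sum_congr rfl fun a _ => congrArg f (hammPt_snoc hb T n c a)).trans ?_
    rw [ih fun p => f (p.1 / b + (T n c : ℕ) / (b : ℝ), p.2 + (c : ℕ) / (b : ℝ) ^ (n + 1))]
    refine Finset.sum_congr rfl fun q _ => ?_
    rw [scramble_succ T n q c.isLt, permVal_fin]
    congr 2
    · push_cast
      field_simp
      ring
    · push_cast
      field_simp
      ring

lemma localDisc_hammPt {b : ℕ} (hb : 0 < b) (T : ℕ → Equiv.Perm (Fin b)) {n i j : ℕ}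
    (hj : j < b ^ n) {x y : ℝ}
    (hx : x ∈ Set.Ioo ((i : ℝ) / (b ^ n : ℕ)) (((i : ℝ) + 1) / (b ^ n : ℕ)))
    (hy : y ∈ Set.Ioo ((j : ℝ) / (b ^ n : ℕ)) (((j : ℝ) + 1) / (b ^ n : ℕ))) :
    localDisc (hammPt b n fun i => T i) x y
      = gridCount T n (i + 1) (j + 1) - (b ^ n : ℕ) * x * y := by
  have hN : (0 : ℝ) < (b ^ n : ℕ) := by positivity
  have key : ∀ {k m : ℕ} {z : ℝ},
      z ∈ Set.Ioo ((k : ℝ) / (b ^ n : ℕ)) (((k : ℝ) + 1) / (b ^ n : ℕ)) →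
      ((m : ℝ) / b ^ n < z ↔ m < k + 1) := fun {k m z} hz => by
    rw [← Nat.cast_pow, div_lt_iff₀ hN]
    have h1 := (div_lt_iff₀ hN).1 hz.1
    have h2 := (lt_div_iff₀ hN).1 hz.2
    constructor
    · intro h
      exact_mod_cast h.trans h2
    · intro h
      have : (m : ℝ) ≤ k := by exact_mod_cast Nat.lt_succ_iff.1 h
      linarith
  unfold localDisc
  congr 1
  · rw [Finset.card_filter]
    push_cast
    rw [sum_hammPt hb T n fun p => if 0 ≤ p.1 ∧ p.1 < x ∧ 0 ≤ p.2 ∧ p.2 < y then 1 else 0,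
      gridCount_eq_sum T n _ (Nat.succ_le_of_lt hj)]
    refine Finset.sum_congr rfl fun Y _ => ?_
    have h1 : (0 : ℝ) ≤ (scramble T n Y : ℝ) / b ^ n := by positivity
    have h2 : (0 : ℝ) ≤ (Y : ℝ) / b ^ n := by positivity
    simp only [h1, h2, true_and, key hx, key hy]
    by_cases h3 : Y < j + 1 <;> by_cases h4 : scramble T n Y < i + 1 <;> simp [h3, h4]
  · simp

lemma integral_box {m : ℕ} (hm : 0 < m) (A : ℝ) (i j : ℕ) :
    ∫ x in ((i : ℝ) / m)..(((i : ℝ) + 1) / m), ∫ y in ((j : ℝ) / m)..(((j : ℝ) + 1) / m),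
        (A - m * x * y) ^ 2
      = (A ^ 2 - 2 * A * (i + 1 / 2) * (j + 1 / 2) / m
          + ((i : ℝ) ^ 2 + i + 1 / 3) * ((j : ℝ) ^ 2 + j + 1 / 3) / (m : ℝ) ^ 2) / (m : ℝ) ^ 2 := by
  have hm' : (m : ℝ) ≠ 0 := by positivity
  have h1 : ∀ x : ℝ, ∫ y in ((j : ℝ) / m)..(((j : ℝ) + 1) / m), (A - m * x * y) ^ 2
      = A ^ 2 / m + (-2 * A * (j + 1 / 2) / m) * x
        + (((j : ℝ) ^ 2 + j + 1 / 3) / m) * x ^ 2 := fun x => by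
    have h2 : ∀ y : ℝ, (A - m * x * y) ^ 2
        = A ^ 2 + (-2 * A * m * x) * y + (m * x) ^ 2 * y ^ 2 := fun y => by ring
    simp only [h2, integral_quadratic]
    field_simp
    ring
  simp only [h1, integral_quadratic]
  field_simp
  ring

lemma sum_box_poly (m : ℕ) :
    ∑ i ∈ range m, ∑ j ∈ range m,
      (((i : ℝ) + 1) ^ 2 * ((j : ℝ) + 1) ^ 2
        - 2 * ((i + 1) * (i + 1 / 2) * ((j + 1) * (j + 1 / 2)))
        + ((i : ℝ) ^ 2 + i + 1 / 3) * ((j : ℝ) ^ 2 + j + 1 / 3))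
      = (m : ℝ) ^ 2 * (25 / 72 * (m : ℝ) ^ 2 + m / 4 + 1 / 72) := by
  simp only [Finset.sum_add_distrib, Finset.sum_sub_distrib, ← Finset.mul_sum, ← Finset.sum_mul]
  have h1 : ∑ i ∈ range m, ((i : ℝ) + 1) ^ 2 = (m : ℝ) * (m + 1) * (2 * m + 1) / 6 := by
    simp only [add_sq, Finset.sum_add_distrib, ← Finset.mul_sum, ← Finset.sum_mul,
      sum_range_sq_real, sum_range_id_real]
    simp
    ring
  have h2 : ∑ i ∈ range m, ((i : ℝ) + 1) * (i + 1 / 2)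
      = (m : ℝ) * (m + 1) * (2 * m + 1) / 6 - m * (m + 1) / 4 := by
    have : ∀ i : ℝ, (i + 1) * (i + 1 / 2) = i ^ 2 + i * (3 / 2) + 1 / 2 := fun i => by ring
    simp only [this, Finset.sum_add_distrib, ← Finset.sum_mul, sum_range_sq_real,
      sum_range_id_real]
    simp
    ring
  simp only [h1, h2, sum_range_sq_real, sum_range_id_real]
  simp
  ring

lemma integral_localDisc_sq {b : ℕ} (hb : 0 < b) (T : ℕ → Equiv.Perm (Fin b))
    (hT : ∀ j, ∀ a < b, permVal (T j) (b - 1 - a) = b - 1 - permVal (T j) a) (n : ℕ) :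
    ∫ x in (0:ℝ)..1, ∫ y in (0:ℝ)..1, (localDisc (hammPt b n fun i => T i) x y) ^ 2
      = gridSqSum T n / ((b : ℝ) ^ n) ^ 2
        + gridSum T n / ((b : ℝ) ^ n) ^ 2 * (1 - 1 / (2 * (b : ℝ) ^ n))
        + 25 / 72 + 1 / (4 * (b : ℝ) ^ n) + 1 / (72 * ((b : ℝ) ^ n) ^ 2) := by
  have hm : 0 < b ^ n := by positivity
  have hN : (b : ℝ) ^ n ≠ 0 := by positivity
  have h1 : ∀ i < b ^ n, ∀ x ∈ Set.Ioo ((i : ℝ) / (b ^ n : ℕ)) (((i : ℝ) + 1) / (b ^ n : ℕ)),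
      ∫ y in (0:ℝ)..1, (localDisc (hammPt b n fun i => T i) x y) ^ 2
      = ∑ j ∈ range (b ^ n), ∫ y in ((j : ℝ) / (b ^ n : ℕ))..(((j : ℝ) + 1) / (b ^ n : ℕ)),
          (gridCount T n (i + 1) (j + 1) - (b ^ n : ℕ) * x * y) ^ 2 := fun i _ x hx =>
    integral_piecewise hm
      (p := fun j y => (gridCount T n (i + 1) (j + 1) - (b ^ n : ℕ) * x * y) ^ 2)
      (fun j => by fun_prop) fun j hj y hy => by rw [localDisc_hammPt hb T hj hx hy]
  have hcont : ∀ (i j : ℕ), Continuous fun x : ℝ =>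
      ∫ y in ((j : ℝ) / (b ^ n : ℕ))..(((j : ℝ) + 1) / (b ^ n : ℕ)),
          (gridCount T n (i + 1) (j + 1) - (b ^ n : ℕ) * x * y) ^ 2 := fun i j =>
    intervalIntegral.continuous_parametric_intervalIntegral_of_continuous' (by fun_prop) _ _
  rw [integral_piecewise hm
    (f := fun x => ∫ y in (0:ℝ)..1, (localDisc (hammPt b n fun i => T i) x y) ^ 2)
    (p := fun i x => ∑ j ∈ range (b ^ n),
      ∫ y in ((j : ℝ) / (b ^ n : ℕ))..(((j : ℝ) + 1) / (b ^ n : ℕ)),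
          (gridCount T n (i + 1) (j + 1) - (b ^ n : ℕ) * x * y) ^ 2)
    (fun i => continuous_finsetSum _ fun j _ => hcont i j) h1]
  have h2 : ∀ i : ℕ, ∫ x in ((i : ℝ) / (b ^ n : ℕ))..(((i : ℝ) + 1) / (b ^ n : ℕ)),
      (∑ j ∈ range (b ^ n), ∫ y in ((j : ℝ) / (b ^ n : ℕ))..(((j : ℝ) + 1) / (b ^ n : ℕ)),
          (gridCount T n (i + 1) (j + 1) - (b ^ n : ℕ) * x * y) ^ 2)
      = ∑ j ∈ range (b ^ n),
          ((gridDisc T n (i + 1) (j + 1) ^ 2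
            + gridDisc T n (i + 1) (j + 1)
              * (((i + 1 : ℕ) : ℝ) + ((j + 1 : ℕ) : ℝ) - 1 / 2) / (b : ℝ) ^ n)
            / ((b : ℝ) ^ n) ^ 2
          + (((i : ℝ) + 1) ^ 2 * ((j : ℝ) + 1) ^ 2
            - 2 * ((i + 1) * (i + 1 / 2) * ((j + 1) * (j + 1 / 2)))
            + ((i : ℝ) ^ 2 + i + 1 / 3) * ((j : ℝ) ^ 2 + j + 1 / 3)) / ((b : ℝ) ^ n) ^ 4) :=
    fun i => by
      rw [intervalIntegral.integral_finsetSum fun j _ => (hcont i j).intervalIntegrable _ _]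
      refine Finset.sum_congr rfl fun j _ => ?_
      rw [integral_box hm, gridDisc]
      push_cast
      field_simp
      ring
  simp only [h2, Finset.sum_add_distrib, ← Finset.sum_div]
  have h3 := sum_box_poly (b ^ n)
  simp only [Finset.sum_add_distrib] at h3
  rw [h3]
  have h4 : ∀ w : ℕ → ℕ → ℝ, ∑ i ∈ range (b ^ n), ∑ j ∈ range (b ^ n),
      gridDisc T n (i + 1) (j + 1) * w (i + 1) (j + 1)
      = ∑ i ∈ range (b ^ n), ∑ j ∈ range (b ^ n), gridDisc T n i j * w i j := fun w => by
    rw [sum_shift_of_ends (m := b ^ n)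
      (u := fun i => ∑ j ∈ range (b ^ n), gridDisc T n i (j + 1) * w i (j + 1))
      (by simp [gridDisc_zero_left, gridDisc_top_left hb])]
    refine Finset.sum_congr rfl fun i hi => ?_
    exact sum_shift_of_ends (m := b ^ n) (u := fun j => gridDisc T n i j * w i j)
      (by simp [gridDisc_zero_right, gridDisc_top_right hb T n (Finset.mem_range.1 hi).le])
  have h5 := h4 fun i j => gridDisc T n i j
  have h6 := h4 fun i j => (i : ℝ) + j - 1 / 2
  have h7 := sum_gridDisc_mul_add hb T hT n
  have h8 : ∑ i ∈ range (b ^ n), ∑ j ∈ range (b ^ n), gridDisc T n i j * ((i : ℝ) + j - 1 / 2)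
      = (b : ℝ) ^ n * gridSum T n - 1 / 2 * gridSum T n := by
    rw [← h7]
    simp only [mul_sub, Finset.sum_sub_distrib, ← Finset.sum_mul, gridSum]
    ring
  simp only [← sq] at h5
  rw [h5, h6, h8, gridSqSum]
  push_cast
  field_simp
  ring

lemma gridSum_eq {b : ℕ} (hb : 0 < b) (T : ℕ → Equiv.Perm (Fin b)) {G : ℝ} {s : ℕ → ℝ}
    (hs : ∀ j, discSum (T j) = s j * G) (n : ℕ) :
    gridSum T n = ((b : ℝ) ^ n) ^ 2 * (G / (b : ℝ) ^ 2) * ∑ j ∈ range n, s j := by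
  have hb' : (b : ℝ) ≠ 0 := by positivity
  induction n with
  | zero => simp [gridSum, gridDisc_zero_left]
  | succ n ih =>
    rw [gridSum_succ hb, ih, hs, Finset.sum_range_succ]
    field_simp
    ring

lemma gridSqSum_eq {b : ℕ} (hb : 0 < b) (T : ℕ → Equiv.Perm (Fin b)) {G G₂ : ℝ} {s : ℕ → ℝ}
    (hs : ∀ j, discSum (T j) = s j * G) (hs1 : ∀ j, s j ^ 2 = 1)
    (hs2 : ∀ j, discSqSum (T j) = G₂) (n : ℕ) :
    gridSqSum T n = ((b : ℝ) ^ n) ^ 2 * ((G / (b : ℝ) ^ 2) ^ 2 * ((∑ j ∈ range n, s j) ^ 2 - n)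
      + n * ((G₂ - ((b : ℝ) ^ 2 - 1) / 36) / (b : ℝ) ^ 2)
      + (1 - 1 / ((b : ℝ) ^ n) ^ 2) / 36) := by
  have hb' : (b : ℝ) ≠ 0 := by positivity
  induction n with
  | zero => simp [gridSqSum, gridDisc_zero_left]
  | succ n ih =>
    rw [gridSqSum_succ hb, ih, gridSum_eq hb T hs, hs, hs2, Finset.sum_range_succ]
    have h1 : (∑ j ∈ range n, s j + s n) ^ 2
        = (∑ j ∈ range n, s j) ^ 2 + 2 * s n * ∑ j ∈ range n, s j + 1 := by
      rw [← hs1 n]; ring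
    rw [h1]
    push_cast
    field_simp
    ring

lemma permVal_reflect {b : ℕ} (σ : Equiv.Perm (Fin b))
    (hcomm : (tauP b).trans σ = σ.trans (tauP b)) {a : ℕ} (ha : a < b) :
    permVal σ (b - 1 - a) = b - 1 - permVal σ a := by
  have h1 := congrArg Fin.val (DFunLike.congr_fun hcomm ⟨a, ha⟩)
  simp only [Equiv.trans_apply, tauP, Fin.revPerm_apply, Fin.val_rev] at h1
  have h2 : Fin.rev (⟨a, ha⟩ : Fin b) = ⟨b - 1 - a, by omega⟩ := by
    ext; simp [Fin.val_rev]; omega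
  rw [h2] at h1
  simp only [permVal, ha, show b - 1 - a < b by omega, dif_pos, h1]
  omega

lemma pbar_ne {b : ℕ} (hb : 2 ≤ b) (σ : Equiv.Perm (Fin b)) : pbar σ ≠ σ := by
  intro h
  have h1 := congrArg Fin.val (DFunLike.congr_fun h (σ.symm ⟨0, by omega⟩))
  simp [pbar, tauP, Fin.val_rev] at h1
  omega

theorem stmt17 (b : ℕ) (hb : 2 ≤ b) (n : ℕ) (hn : 1 ≤ n) (σ : Equiv.Perm (Fin b))
    (hcomm : (tauP b).trans σ = σ.trans (tauP b))
    (S : Fin n → Equiv.Perm (Fin b))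
    (hS : ∀ i, S i = σ ∨ S i = pbar σ) :
    ((b : ℝ) ^ n * L2disc (hammPt b n S)) ^ 2 =
      (PhiS σ) ^ 2 *
          (((n : ℝ) - 2 * ((Finset.univ.filter (fun i => S i = σ)).card : ℝ)) ^ 2 - (n : ℝ))
        + PhiS σ * (1 - 1 / (2 * (b : ℝ) ^ n)) *
            (2 * ((Finset.univ.filter (fun i => S i = σ)).card : ℝ) - (n : ℝ))
        + (n : ℝ) * PhiS2 σ + 3 / 8 + 1 / (4 * (b : ℝ) ^ n)
        - 1 / (72 * (b : ℝ) ^ (2 * n)) := by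
  have hb0 : 0 < b := by omega
  have hN : (b : ℝ) ^ n ≠ 0 := by positivity
  set T : ℕ → Equiv.Perm (Fin b) := fun j => if h : j < n then S ⟨j, h⟩ else σ
  have hTS : (fun i : Fin n => T i) = S := by
    funext i
    simp [T]
  have hT : ∀ j, T j = σ ∨ T j = pbar σ := fun j => by
    by_cases h : j < n
    · simpa [T, h] using hS ⟨j, h⟩
    · simp [T, h]
  have hrefl : ∀ j, ∀ a < b, permVal (T j) (b - 1 - a) = b - 1 - permVal (T j) a := by
    intro j a ha
    rcases hT j with h | h
    · rw [h, permVal_reflect σ hcomm ha]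
    · rw [h, permVal_pbar σ ha, permVal_pbar σ (by omega), permVal_reflect σ hcomm ha]
  set s : ℕ → ℝ := fun j => if T j = σ then 1 else -1
  have hs : ∀ j, discSum (T j) = s j * discSum σ := fun j => by
    rcases hT j with h | h
    · simp [s, h]
    · simp [s, h, pbar_ne hb, discSum_pbar hb0]
  have hs1 : ∀ j, s j ^ 2 = 1 := fun j => by
    by_cases h : T j = σ <;> simp [s, h]
  have hs2 : ∀ j, discSqSum (T j) = discSqSum σ := fun j => by
    rcases hT j with h | h
    · rw [h]
    · rw [h, discSqSum_pbar hb0]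
  have hsum : ∑ j ∈ range n, s j
      = 2 * ((Finset.univ.filter (fun i => S i = σ)).card : ℝ) - n := by
    rw [Finset.sum_range, Finset.card_filter, ← hTS]
    push_cast
    rw [Finset.mul_sum, eq_sub_iff_add_eq]
    conv_lhs => rw [show (n : ℝ) = ∑ i : Fin n, (1 : ℝ) by simp]
    rw [← Finset.sum_add_distrib]
    refine Finset.sum_congr rfl fun i _ => ?_
    by_cases h : T i = σ <;> simp [s, h]
    norm_num
  have hL2 : ((b : ℝ) ^ n * L2disc (hammPt b n S)) ^ 2
      = ∫ x in (0:ℝ)..1, ∫ y in (0:ℝ)..1, (localDisc (hammPt b n S) x y) ^ 2 := by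
    have hcard : (Fintype.card (Fin n → Fin b) : ℝ) = (b : ℝ) ^ n := by simp
    rw [L2disc, hcard, ← mul_assoc, mul_one_div_cancel hN, one_mul, Real.sq_sqrt]
    exact intervalIntegral.integral_nonneg zero_le_one fun x _ =>
      intervalIntegral.integral_nonneg zero_le_one fun y _ => sq_nonneg _
  rw [hL2, ← hTS, integral_localDisc_sq hb0 T hrefl, gridSqSum_eq hb0 T hs hs1 hs2,
    gridSum_eq hb0 T hs, hTS, PhiS_eq hb0, PhiS2_eq hb0, hsum, mul_comm 2 n, pow_mul]
  field_simp
  ring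

end SymHamm
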